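/- Let 𝔾 be a finite subgroup of O(n) × O(m), with associated maps G_{A,B}(x,y,Z) = (Ax, By, B Z Aᵀ) on ℝⁿ × ℝᵐ × ℝ^{m×n} and H_{A,B}(x,y) = (Ax, By) on ℝⁿ × ℝᵐ. Let μ be a finite Borel measure on ℝⁿ × ℝᵐ × ℝ^{m×n} whose Z-marginal has finite first moment, let ν be a finite Borel measure on ℝⁿ × ℝᵐ, and let n̂ : ℝⁿ → ℝⁿ be a bounded Borel map satisfying the equivariance n̂(Ax) = A n̂(x) for all x and all (A,B) ∈ 𝔾. Suppose that for every continuously differentiable φ : ℝⁿ × ℝᵐ → ℝⁿ with bounded values and bounded first derivatives one has ∫ 𝒟φ dμ = ∫ φ(x,y) · n̂(x) dν(x,y). Then the group-averaged measures μ̄ := |𝔾|⁻¹ Σ_{(A,B)∈𝔾} (G_{A,B})♯μ and ν̄ := |𝔾|⁻¹ Σ_{(A,B)∈𝔾} (H_{A,B})♯ν satisfy the same identity: ∫ 𝒟φ dμ̄ = ∫ φ(x,y) · n̂(x) dν̄(x,y) for every such φ. -/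

import Mathlib

open MeasureTheory Matrix
open scoped ENNReal BigOperators

instance {m n : ℕ} : MeasurableSpace (Matrix (Fin m) (Fin n) ℝ) :=
  inferInstanceAs (MeasurableSpace (Fin m → Fin n → ℝ))

/-- The map `G_{A,B}(x, y, Z) = (Ax, By, B Z Aᵀ)` on `ℝⁿ × ℝᵐ × ℝ^{m×n}`. -/
def Gmap {n m : ℕ} (A : Matrix (Fin n) (Fin n) ℝ) (B : Matrix (Fin m) (Fin m) ℝ) :
    (Fin n → ℝ) × (Fin m → ℝ) × Matrix (Fin m) (Fin n) ℝ →
      (Fin n → ℝ) × (Fin m → ℝ) × Matrix (Fin m) (Fin n) ℝ :=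
  fun p => (A.mulVec p.1, B.mulVec p.2.1, B * p.2.2 * A.transpose)

/-- The map `H_{A,B}(x, y) = (Ax, By)` on `ℝⁿ × ℝᵐ`. -/
def Hmap {n m : ℕ} (A : Matrix (Fin n) (Fin n) ℝ) (B : Matrix (Fin m) (Fin m) ℝ) :
    (Fin n → ℝ) × (Fin m → ℝ) → (Fin n → ℝ) × (Fin m → ℝ) :=
  fun q => (A.mulVec q.1, B.mulVec q.2)

/-- The total divergence `𝒟φ(x,y,Z) = Σᵢ [∂φᵢ/∂xᵢ (x,y) + Σⱼ Z_{ji} ∂φᵢ/∂yⱼ (x,y)]`. -/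
noncomputable def totalDiv {n m : ℕ} (φ : (Fin n → ℝ) × (Fin m → ℝ) → Fin n → ℝ)
    (x : Fin n → ℝ) (y : Fin m → ℝ) (Z : Matrix (Fin m) (Fin n) ℝ) : ℝ :=
  ∑ i, (fderiv ℝ φ (x, y) (Pi.single i 1, 0) i
    + ∑ j, Z j i * fderiv ℝ φ (x, y) (0, Pi.single j 1) i)

/-- The linear map `H_{A,B}` as a continuous linear map. -/
noncomputable def HmapCLM {n m : ℕ} (A : Matrix (Fin n) (Fin n) ℝ)
    (B : Matrix (Fin m) (Fin m) ℝ) :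
    (Fin n → ℝ) × (Fin m → ℝ) →L[ℝ] (Fin n → ℝ) × (Fin m → ℝ) :=
  (LinearMap.prodMap A.mulVecLin B.mulVecLin).toContinuousLinearMap

/-- The conjugated test function `φ_{A,B}(x, y) = Aᵀ φ(Ax, By)`. -/
noncomputable def conjTest {n m : ℕ} (A : Matrix (Fin n) (Fin n) ℝ)
    (B : Matrix (Fin m) (Fin m) ℝ) (φ : (Fin n → ℝ) × (Fin m → ℝ) → Fin n → ℝ) :
    (Fin n → ℝ) × (Fin m → ℝ) → Fin n → ℝ :=
  fun q => Aᵀ.mulVecLin.toContinuousLinearMap (φ (HmapCLM A B q))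

theorem totalDiv_eq_trace {n m : ℕ} (φ : (Fin n → ℝ) × (Fin m → ℝ) → Fin n → ℝ)
    (x : Fin n → ℝ) (y : Fin m → ℝ) (Z : Matrix (Fin m) (Fin n) ℝ) :
    totalDiv φ x y Z = LinearMap.trace ℝ (Fin n → ℝ)
      ((fderiv ℝ φ (x, y) : (Fin n → ℝ) × (Fin m → ℝ) →ₗ[ℝ] (Fin n → ℝ)) ∘ₗ
        LinearMap.prod LinearMap.id Z.mulVecLin) := by
  rw [LinearMap.trace_eq_matrix_trace ℝ (Pi.basisFun ℝ (Fin n)), Matrix.trace, totalDiv]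
  refine Finset.sum_congr rfl fun i _ => ?_
  have hcol : ((Pi.single i 1, Z *ᵥ Pi.single i 1) : (Fin n → ℝ) × (Fin m → ℝ))
      = (Pi.single i 1, 0) + ∑ j, Z j i • ((0, Pi.single j 1) : (Fin n → ℝ) × (Fin m → ℝ)) := by
    refine Prod.ext ?_ ?_
    · simp [Prod.fst_sum]
    · ext k
      simp [Prod.snd_sum, Finset.sum_apply, Pi.single_apply]
  have hdiag : (fderiv ℝ φ (x, y) (Pi.single i 1, Z *ᵥ Pi.single i 1)) i
      = fderiv ℝ φ (x, y) (Pi.single i 1, 0) i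
        + ∑ j, Z j i * fderiv ℝ φ (x, y) (0, Pi.single j 1) i := by
    rw [hcol]
    simp only [map_add, map_sum, map_smul, Pi.add_apply, Finset.sum_apply, Pi.smul_apply,
      smul_eq_mul]
  rw [← hdiag]
  simp [LinearMap.toMatrix'_apply]

theorem contDiff_conjTest {n m : ℕ} (A : Matrix (Fin n) (Fin n) ℝ)
    (B : Matrix (Fin m) (Fin m) ℝ) {φ : (Fin n → ℝ) × (Fin m → ℝ) → Fin n → ℝ}
    (hφ : ContDiff ℝ 1 φ) : ContDiff ℝ 1 (conjTest A B φ) :=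
  (ContinuousLinearMap.contDiff _).comp (hφ.comp (ContinuousLinearMap.contDiff _))

theorem fderiv_conjTest {n m : ℕ} (A : Matrix (Fin n) (Fin n) ℝ)
    (B : Matrix (Fin m) (Fin m) ℝ) {φ : (Fin n → ℝ) × (Fin m → ℝ) → Fin n → ℝ}
    (hφ : ContDiff ℝ 1 φ) (q : (Fin n → ℝ) × (Fin m → ℝ)) :
    fderiv ℝ (conjTest A B φ) q = Aᵀ.mulVecLin.toContinuousLinearMap.comp
      ((fderiv ℝ φ (Hmap A B q)).comp (HmapCLM A B)) :=
  ((ContinuousLinearMap.hasFDerivAt _).comp q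
    (((hφ.differentiable one_ne_zero _).hasFDerivAt).comp q
      (HmapCLM A B).hasFDerivAt)).fderiv

theorem bounded_conjTest {n m : ℕ} (A : Matrix (Fin n) (Fin n) ℝ)
    (B : Matrix (Fin m) (Fin m) ℝ) {φ : (Fin n → ℝ) × (Fin m → ℝ) → Fin n → ℝ}
    (hφ : ∃ C, ∀ p, ‖φ p‖ ≤ C) : ∃ C, ∀ p, ‖conjTest A B φ p‖ ≤ C := by
  obtain ⟨C, hC⟩ := hφ
  exact ⟨_, fun p => ContinuousLinearMap.le_opNorm_of_le _ (hC _)⟩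

theorem bounded_fderiv_conjTest {n m : ℕ} (A : Matrix (Fin n) (Fin n) ℝ)
    (B : Matrix (Fin m) (Fin m) ℝ) {φ : (Fin n → ℝ) × (Fin m → ℝ) → Fin n → ℝ}
    (hφ : ContDiff ℝ 1 φ) (hφ' : ∃ C, ∀ p, ‖fderiv ℝ φ p‖ ≤ C) :
    ∃ C, ∀ p, ‖fderiv ℝ (conjTest A B φ) p‖ ≤ C := by
  obtain ⟨C, hC⟩ := hφ'
  refine ⟨‖Aᵀ.mulVecLin.toContinuousLinearMap‖ * (C * ‖HmapCLM A B‖), fun p => ?_⟩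
  rw [fderiv_conjTest A B hφ]
  refine (ContinuousLinearMap.opNorm_comp_le _ _).trans ?_
  gcongr
  refine (ContinuousLinearMap.opNorm_comp_le _ _).trans ?_
  gcongr
  exact hC _

theorem totalDiv_conjTest {n m : ℕ} {A : Matrix (Fin n) (Fin n) ℝ}
    (hA : A ∈ Matrix.orthogonalGroup (Fin n) ℝ)
    (B : Matrix (Fin m) (Fin m) ℝ) {φ : (Fin n → ℝ) × (Fin m → ℝ) → Fin n → ℝ}
    (hφ : ContDiff ℝ 1 φ) (p : (Fin n → ℝ) × (Fin m → ℝ) × Matrix (Fin m) (Fin n) ℝ) :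
    totalDiv (conjTest A B φ) p.1 p.2.1 p.2.2
      = totalDiv φ (Gmap A B p).1 (Gmap A B p).2.1 (Gmap A B p).2.2 := by
  have hAt : Aᵀ * A = 1 := (Matrix.mem_orthogonalGroup_iff' (Fin n) ℝ).1 hA
  have hAt' : A * Aᵀ = 1 := (Matrix.mem_orthogonalGroup_iff (Fin n) ℝ).1 hA
  obtain ⟨x, y, Z⟩ := p
  rw [totalDiv_eq_trace, totalDiv_eq_trace, fderiv_conjTest A B hφ]
  set L : (Fin n → ℝ) →ₗ[ℝ] (Fin n → ℝ) :=
    (fderiv ℝ φ (A *ᵥ x, B *ᵥ y) : (Fin n → ℝ) × (Fin m → ℝ) →ₗ[ℝ] (Fin n → ℝ)) ∘ₗ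
      LinearMap.prod LinearMap.id (B * Z * Aᵀ).mulVecLin with hL
  calc _ = LinearMap.trace ℝ (Fin n → ℝ) (Aᵀ.mulVecLin ∘ₗ (L ∘ₗ A.mulVecLin)) := by
        congr 1
        refine LinearMap.ext fun v => ?_
        change Aᵀ *ᵥ (fderiv ℝ φ (A *ᵥ x, B *ᵥ y) (A *ᵥ v, B *ᵥ (Z *ᵥ v)))
          = Aᵀ *ᵥ (fderiv ℝ φ (A *ᵥ x, B *ᵥ y) (A *ᵥ v, (B * Z * Aᵀ) *ᵥ (A *ᵥ v)))
        rw [Matrix.mulVec_mulVec, Matrix.mulVec_mulVec, Matrix.mul_assoc (B * Z), hAt,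
          Matrix.mul_one]
    _ = LinearMap.trace ℝ (Fin n → ℝ) ((L ∘ₗ A.mulVecLin) ∘ₗ Aᵀ.mulVecLin) :=
        LinearMap.trace_comp_comm' _ _
    _ = LinearMap.trace ℝ (Fin n → ℝ) L := by
        rw [LinearMap.comp_assoc, ← Matrix.mulVecLin_mul, hAt', Matrix.mulVecLin_one,
          LinearMap.comp_id]

theorem measurable_matrix_entry {m n : ℕ} (i : Fin m) (j : Fin n) :
    Measurable fun Z : Matrix (Fin m) (Fin n) ℝ => Z i j :=
  (measurable_pi_apply j).comp (measurable_pi_apply (X := fun _ : Fin m => Fin n → ℝ) i)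

theorem measurable_Hmap {n m : ℕ} (A : Matrix (Fin n) (Fin n) ℝ)
    (B : Matrix (Fin m) (Fin m) ℝ) : Measurable (Hmap A B) :=
  (HmapCLM A B).continuous.measurable

theorem measurable_Gmap {n m : ℕ} (A : Matrix (Fin n) (Fin n) ℝ)
    (B : Matrix (Fin m) (Fin m) ℝ) : Measurable (Gmap A B) := by
  have hx : Measurable fun x : Fin n → ℝ => A *ᵥ x :=
    A.mulVecLin.toContinuousLinearMap.continuous.measurable
  have hy : Measurable fun y : Fin m → ℝ => B *ᵥ y :=
    B.mulVecLin.toContinuousLinearMap.continuous.measurable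
  have hZ : Measurable fun Z : Matrix (Fin m) (Fin n) ℝ => B * Z * Aᵀ := by
    refine measurable_pi_lambda (X := fun _ : Fin m => Fin n → ℝ) _ fun i =>
      measurable_pi_lambda _ fun j => ?_
    simp only [Matrix.mul_apply]
    exact Finset.measurable_fun_sum _ fun k _ => (Finset.measurable_fun_sum _ fun l _ =>
      (measurable_matrix_entry l k).const_mul _).mul_const _
  exact (hx.comp measurable_fst).prodMk ((hy.comp (measurable_fst.comp measurable_snd)).prodMk
    (hZ.comp (measurable_snd.comp measurable_snd)))

theorem measurable_totalDiv {n m : ℕ} {φ : (Fin n → ℝ) × (Fin m → ℝ) → Fin n → ℝ}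
    (hφ : ContDiff ℝ 1 φ) :
    Measurable fun p : (Fin n → ℝ) × (Fin m → ℝ) × Matrix (Fin m) (Fin n) ℝ =>
      totalDiv φ p.1 p.2.1 p.2.2 := by
  have hD (v : (Fin n → ℝ) × (Fin m → ℝ)) (i : Fin n) :
      Measurable fun p : (Fin n → ℝ) × (Fin m → ℝ) × Matrix (Fin m) (Fin n) ℝ =>
        fderiv ℝ φ (p.1, p.2.1) v i := by
    have hc : Continuous fun q => fderiv ℝ φ q v i :=
      (continuous_apply i).comp ((hφ.continuous_fderiv one_ne_zero).clm_apply continuous_const)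
    exact hc.measurable.comp
      (measurable_fst.prodMk (measurable_fst.comp measurable_snd))
  exact Finset.measurable_fun_sum _ fun i _ => (hD _ i).add
    (Finset.measurable_fun_sum _ fun j _ =>
      ((measurable_matrix_entry j i).comp (measurable_snd.comp measurable_snd)).mul (hD _ i))

theorem integrable_totalDiv {n m : ℕ}
    {μ : Measure ((Fin n → ℝ) × (Fin m → ℝ) × Matrix (Fin m) (Fin n) ℝ)} [IsFiniteMeasure μ]
    (hμ : Integrable (fun p => ∑ i, ∑ j, |p.2.2 i j|) μ)
    {φ : (Fin n → ℝ) × (Fin m → ℝ) → Fin n → ℝ} (hφ : ContDiff ℝ 1 φ)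
    (hφ' : ∃ C, ∀ p, ‖fderiv ℝ φ p‖ ≤ C) :
    Integrable (fun p => totalDiv φ p.1 p.2.1 p.2.2) μ := by
  obtain ⟨C, hC⟩ := hφ'
  have hD (q v : (Fin n → ℝ) × (Fin m → ℝ)) (hv : ‖v‖ ≤ 1) (i : Fin n) :
      |fderiv ℝ φ q v i| ≤ C := by
    have h := (norm_le_pi_norm (fderiv ℝ φ q v) i).trans
      ((fderiv ℝ φ q).le_of_opNorm_le_of_le (hC q) hv)
    simpa using h
  refine Integrable.mono' ((integrable_const (∑ _i : Fin n, C)).add (hμ.mul_const C))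
    (measurable_totalDiv hφ).aestronglyMeasurable (Filter.Eventually.of_forall fun p => ?_)
  obtain ⟨x, y, Z⟩ := p
  calc ‖totalDiv φ x y Z‖ ≤ ∑ i : Fin n, (C + ∑ j, |Z j i| * C) := by
        refine (norm_sum_le _ _).trans (Finset.sum_le_sum fun i _ => ?_)
        refine (norm_add_le _ _).trans (add_le_add (hD _ _ ?_ i) ?_)
        · simp [Prod.norm_def, Pi.norm_single]
        · refine (norm_sum_le _ _).trans (Finset.sum_le_sum fun j _ => ?_)
          rw [norm_mul, Real.norm_eq_abs, Real.norm_eq_abs]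
          refine mul_le_mul_of_nonneg_left (hD _ _ ?_ i) (abs_nonneg _)
          simp [Prod.norm_def, Pi.norm_single]
    _ = (∑ _i : Fin n, C) + (∑ j, ∑ i, |Z j i|) * C := by
        rw [Finset.sum_add_distrib, Finset.sum_comm]
        simp only [Finset.sum_mul]

theorem integrable_dotProduct_of_bounded {α : Type*} [MeasurableSpace α] {n : ℕ}
    {ν : Measure α} [IsFiniteMeasure ν] {f g : α → Fin n → ℝ}
    (hf : Measurable f) (hg : Measurable g)
    (hfb : ∃ C, ∀ q, ‖f q‖ ≤ C) (hgb : ∃ C, ∀ q, ‖g q‖ ≤ C) :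
    Integrable (fun q => f q ⬝ᵥ g q) ν := by
  obtain ⟨C, hC⟩ := hfb
  obtain ⟨D, hD⟩ := hgb
  refine integrable_finsetSum _ fun i _ => ?_
  refine Integrable.of_bound (((measurable_pi_apply i).comp hf).mul
    ((measurable_pi_apply i).comp hg)).aestronglyMeasurable (C * D)
    (Filter.Eventually.of_forall fun q => ?_)
  rw [norm_mul]
  exact mul_le_mul ((norm_le_pi_norm _ i).trans (hC q)) ((norm_le_pi_norm _ i).trans (hD q))
    (norm_nonneg _) ((norm_nonneg _).trans (hC q))

/-- If the pair `(μ, ν)` satisfies the divergence-theorem identity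
`∫ 𝒟φ dμ = ∫ φ · n̂ dν` for all bounded `C¹` functions `φ` with bounded derivative,
where `n̂` is bounded, Borel, and `𝔾`-equivariant, then the group-averaged pair
`(μ̄, ν̄)` satisfies the same identity. -/
theorem group_averaged_measures_satisfy_divergence_identity {n m : ℕ}
    (G : Subgroup (Matrix.orthogonalGroup (Fin n) ℝ × Matrix.orthogonalGroup (Fin m) ℝ))
    [Fintype G]
    (μ : Measure ((Fin n → ℝ) × (Fin m → ℝ) × Matrix (Fin m) (Fin n) ℝ))
    [IsFiniteMeasure μ]
    (ν : Measure ((Fin n → ℝ) × (Fin m → ℝ))) [IsFiniteMeasure ν]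
    (hμmom : Integrable (fun p => ∑ i, ∑ j, |p.2.2 i j|) μ)
    (nhat : (Fin n → ℝ) → Fin n → ℝ)
    (hn_meas : Measurable nhat) (hn_bdd : ∃ C, ∀ x, ‖nhat x‖ ≤ C)
    (hn_equiv : ∀ g : G, ∀ x : Fin n → ℝ,
      nhat ((g.1.1 : Matrix (Fin n) (Fin n) ℝ).mulVec x)
        = (g.1.1 : Matrix (Fin n) (Fin n) ℝ).mulVec (nhat x))
    (hdiv : ∀ φ : (Fin n → ℝ) × (Fin m → ℝ) → Fin n → ℝ, ContDiff ℝ 1 φ →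
      (∃ C, ∀ p, ‖φ p‖ ≤ C) → (∃ C, ∀ p, ‖fderiv ℝ φ p‖ ≤ C) →
      ∫ p, totalDiv φ p.1 p.2.1 p.2.2 ∂μ = ∫ q, φ q ⬝ᵥ nhat q.1 ∂ν)
    (μbar : Measure ((Fin n → ℝ) × (Fin m → ℝ) × Matrix (Fin m) (Fin n) ℝ))
    (νbar : Measure ((Fin n → ℝ) × (Fin m → ℝ)))
    (hμbar : μbar = (Fintype.card G : ℝ≥0∞)⁻¹ •
      ∑ g : G, Measure.map
        (Gmap (g.1.1 : Matrix (Fin n) (Fin n) ℝ) (g.1.2 : Matrix (Fin m) (Fin m) ℝ)) μ)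
    (hνbar : νbar = (Fintype.card G : ℝ≥0∞)⁻¹ •
      ∑ g : G, Measure.map
        (Hmap (g.1.1 : Matrix (Fin n) (Fin n) ℝ) (g.1.2 : Matrix (Fin m) (Fin m) ℝ)) ν) :
    ∀ φ : (Fin n → ℝ) × (Fin m → ℝ) → Fin n → ℝ, ContDiff ℝ 1 φ →
      (∃ C, ∀ p, ‖φ p‖ ≤ C) → (∃ C, ∀ p, ‖fderiv ℝ φ p‖ ≤ C) →
      ∫ p, totalDiv φ p.1 p.2.1 p.2.2 ∂μbar = ∫ q, φ q ⬝ᵥ nhat q.1 ∂νbar := by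
  intro φ hφ hφb hφ'
  have hdot : Measurable fun q : (Fin n → ℝ) × (Fin m → ℝ) => nhat q.1 :=
    hn_meas.comp measurable_fst
  have hnb : ∃ C, ∀ q : (Fin n → ℝ) × (Fin m → ℝ), ‖nhat q.1‖ ≤ C :=
    hn_bdd.imp fun _ h q => h q.1
  have hμint (g : G) : Integrable (fun p => totalDiv φ p.1 p.2.1 p.2.2)
      (μ.map (Gmap (g.1.1 : Matrix (Fin n) (Fin n) ℝ) (g.1.2 : Matrix (Fin m) (Fin m) ℝ))) := by
    rw [integrable_map_measure (measurable_totalDiv hφ).aestronglyMeasurable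
      (measurable_Gmap _ _).aemeasurable]
    refine (integrable_totalDiv hμmom (contDiff_conjTest g.1.1.1 g.1.2.1 hφ)
      (bounded_fderiv_conjTest g.1.1.1 g.1.2.1 hφ hφ')).congr
      (Filter.Eventually.of_forall fun p => ?_)
    exact totalDiv_conjTest g.1.1.2 _ hφ p
  have hνint (g : G) : Integrable (fun q => φ q ⬝ᵥ nhat q.1)
      (ν.map (Hmap (g.1.1 : Matrix (Fin n) (Fin n) ℝ) (g.1.2 : Matrix (Fin m) (Fin m) ℝ))) :=
    integrable_dotProduct_of_bounded hφ.continuous.measurable hdot hφb hnb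
  rw [hμbar, hνbar, integral_smul_measure, integral_smul_measure,
    integral_finsetSum_measure fun g _ => hμint g, integral_finsetSum_measure fun g _ => hνint g]
  congr 1
  refine Finset.sum_congr rfl fun g _ => ?_
  rw [integral_map (measurable_Gmap _ _).aemeasurable (hμint g).aestronglyMeasurable,
    integral_map (measurable_Hmap _ _).aemeasurable (hνint g).aestronglyMeasurable]
  calc _ = ∫ p, totalDiv (conjTest g.1.1.1 g.1.2.1 φ) p.1 p.2.1 p.2.2 ∂μ :=
        integral_congr_ae (Filter.Eventually.of_forall fun p =>
          (totalDiv_conjTest g.1.1.2 _ hφ p).symm)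
    _ = ∫ q, conjTest g.1.1.1 g.1.2.1 φ q ⬝ᵥ nhat q.1 ∂ν :=
        hdiv _ (contDiff_conjTest _ _ hφ) (bounded_conjTest _ _ hφb)
          (bounded_fderiv_conjTest _ _ hφ hφ')
    _ = _ := by
        refine integral_congr_ae (Filter.Eventually.of_forall fun q => ?_)
        change (g.1.1.1ᵀ *ᵥ φ (Hmap g.1.1.1 g.1.2.1 q)) ⬝ᵥ nhat q.1
          = φ (Hmap g.1.1.1 g.1.2.1 q) ⬝ᵥ nhat (g.1.1.1 *ᵥ q.1)
        rw [hn_equiv g, Matrix.dotProduct_mulVec, Matrix.mulVec_transpose]
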